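/- Assume e = N = 3, p ≡ 2 (mod 3) (the case p = 2 is allowed), and 3 divides (q−1)/h. Then ms is even, and setting ε = (−1)^{ms/2} p^{ms/2} (= (−1)^{ms/2}√r), the modified weight λ(a,b), as (a,b) ranges over GF(r)², takes only the values −h(2ε+1)/q, h(ε−1)/q, −h(ε+1)/q, −h/q, h(r−4ε−3)/(3q), h(r+2ε−3)/(3q), h(r−1)/q; and for every real number x, the number of pairs (a,b) ∈ GF(r)² with λ(a,b) = x equals the sum of the following frequencies over those listed values that equal x: value −h(2ε+1)/q with frequency (r−1)(r−8−2ε)/27; value h(ε−1)/q with frequency 2(r−1)(4r−14+ε)/27; value −h(ε+1)/q with frequency 2(r−1)(r−2+ε)/9; value −h/q with frequency 2(r−1)(2r−1−ε)/9; value h(r−4ε−3)/(3q) with frequency r−1; value h(r+2ε−3)/(3q) with frequency 2(r−1); value h(r−1)/q with frequency 1. -/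

import Mathlib

open scoped Classical
open Finset

/-- The cubic class of an element of a finite field with `3 * f + 1` elements:
`0` for zero, `1` for nonzero cubes, `2` for the other elements. -/
noncomputable def cubicClass {F : Type} [Field F] (f : ℕ) (x : F) : Fin 3 :=
  if x = 0 then 0 else if x ^ f = 1 then 1 else 2

/-- The sum of an additive character over a dilate of a cubic class. -/
noncomputable def classSum {F : Type} [Field F] [Fintype F] (ψ : AddChar F ℂ) (f : ℕ)
    (i : Fin 3) (c : F) : ℂ :=
  ∑ x with cubicClass f x = i, ψ (c * x)

section CubicClass

variable {F : Type} [Field F] {f : ℕ}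

theorem cubicClass_eq_zero_iff {x : F} : cubicClass f x = 0 ↔ x = 0 := by
  unfold cubicClass; split_ifs <;> simp_all

theorem cubicClass_eq_one_iff {x : F} : cubicClass f x = 1 ↔ x ≠ 0 ∧ x ^ f = 1 := by
  unfold cubicClass; split_ifs <;> simp_all

theorem cubicClass_mul {x y : F} (hy : cubicClass f y = 1) :
    cubicClass f (x * y) = cubicClass f x := by
  obtain ⟨hy0, hy1⟩ := cubicClass_eq_one_iff.1 hy
  simp [cubicClass, mul_pow, hy0, hy1]

theorem cubicClass_pow_of_coprime {p : ℕ} (hp : p ≠ 0) (hp3 : p % 3 = 2) {x : F}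
    (hx : (x ^ f) ^ 3 = 1 ∨ x = 0) : cubicClass f (x ^ p) = cubicClass f x := by
  unfold cubicClass
  by_cases h0 : x = 0
  · simp [h0, hp]
  have h3 := hx.resolve_right h0
  have hpow : (x ^ p) ^ f = (x ^ f) ^ 2 := by
    rw [← pow_mul, mul_comm, pow_mul]
    conv_lhs => rw [← Nat.div_add_mod p 3, hp3, pow_add, pow_mul, h3, one_pow, one_mul]
  have hiff : (x ^ f) ^ 2 = 1 ↔ x ^ f = 1 := by
    constructor
    · intro h
      rwa [pow_succ, h, one_mul] at h3
    · intro h; simp [h]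
  simp [h0, hp, hpow, hiff]

variable [Fintype F]

theorem pow_third_pow_three (hF : Fintype.card F = 3 * f + 1) {x : F} (hx : x ≠ 0) :
    (x ^ f) ^ 3 = 1 := by
  rw [← pow_mul, mul_comm, ← FiniteField.pow_card_sub_one_eq_one x hx, hF, Nat.add_sub_cancel]

theorem cubicClass_neg_one (hF : Fintype.card F = 3 * f + 1) : cubicClass f (-1 : F) = 1 := by
  refine cubicClass_eq_one_iff.2 ⟨by simp, ?_⟩
  have h := pow_third_pow_three hF (x := (-1 : F)) (by simp)
  rwa [← pow_mul, mul_comm, pow_mul, Odd.neg_one_pow (by decide)] at h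

theorem cubicClass_neg (hF : Fintype.card F = 3 * f + 1) (x : F) :
    cubicClass f (-x) = cubicClass f x := by
  rw [← cubicClass_mul (x := x) (cubicClass_neg_one hF), mul_neg_one]

theorem filter_cubicClass_zero : ({x : F | cubicClass f x = 0} : Finset F) = {0} := by
  ext x; simp [cubicClass_eq_zero_iff]

theorem card_cubicClass_zero : #{x : F | cubicClass f x = 0} = 1 := by
  rw [filter_cubicClass_zero, card_singleton]

theorem card_cubicClass_one (hF : Fintype.card F = 3 * f + 1) :
    #{x : F | cubicClass f x = 1} = f := by
  have h := IsCyclic.card_powMonoidHom_ker (G := Fˣ) f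
  rw [Nat.card_eq_fintype_card (α := Fˣ), Fintype.card_units, hF, Nat.add_sub_cancel,
    Nat.gcd_mul_left_left] at h
  have h' : #{u : Fˣ | u ^ f = 1} = f := by
    refine Eq.trans (Nat.subtype_card _ fun u => ?_).symm h
    simp [MonoidHom.mem_ker]
  conv_rhs => rw [← h']
  symm
  refine Finset.card_bij (fun u _ => (u : F)) ?_ (fun _ _ _ _ h => Units.ext h) ?_
  · intro u hu
    have hu : u ^ f = 1 := by simpa using hu
    simp [cubicClass_eq_one_iff, ← Units.val_pow_eq_pow_val, hu]
  · intro x hx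
    obtain ⟨hx0, hx1⟩ := cubicClass_eq_one_iff.1 (by simpa using hx)
    exact ⟨Units.mk0 x hx0, by simpa [Units.ext_iff] using hx1, rfl⟩

theorem card_cubicClass_two (hF : Fintype.card F = 3 * f + 1) :
    #{x : F | cubicClass f x = 2} = 2 * f := by
  have h := Finset.card_eq_sum_card_fiberwise (s := (univ : Finset F)) (t := univ)
    (f := cubicClass f) (fun _ _ => by simp)
  rw [Fin.sum_univ_three, card_cubicClass_zero, card_cubicClass_one hF, card_univ, hF] at h
  omega

theorem sum_comp_cubicClass (hF : Fintype.card F = 3 * f + 1) (G : Fin 3 → ℂ) :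
    ∑ c : F, G (cubicClass f c) = G 0 + f * G 1 + 2 * f * G 2 := by
  rw [← Finset.sum_fiberwise_of_maps_to (s := univ) (t := univ) (g := cubicClass f)
    (fun _ _ => by simp)]
  have (i : Fin 3) : ∑ c : F with cubicClass f c = i, G (cubicClass f c)
      = #{x : F | cubicClass f x = i} * G i := by
    rw [Finset.sum_congr rfl (g := fun _ => G i) (by simp +contextual)]
    simp
  rw [Fin.sum_univ_three, this, this, this, card_cubicClass_zero, card_cubicClass_one hF,
    card_cubicClass_two hF]
  push_cast; ring

end CubicClass

section ClassSum

variable {F : Type} [Field F] [Fintype F] {f : ℕ} {ψ : AddChar F ℂ}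

theorem classSum_mul {i : Fin 3} {c y : F} (hy : cubicClass f y = 1) :
    classSum ψ f i (c * y) = classSum ψ f i c := by
  have hy0 := (cubicClass_eq_one_iff.1 hy).1
  unfold classSum
  refine Finset.sum_bijective (fun x => y * x) (mulLeft_bijective₀ y hy0) ?_ ?_
  · intro x
    simp [mul_comm y x, cubicClass_mul hy]
  · intro x _
    rw [mul_assoc]

theorem classSum_neg (hF : Fintype.card F = 3 * f + 1) (i : Fin 3) (c : F) :
    classSum ψ f i (-c) = classSum ψ f i c := by
  rw [← classSum_mul (c := c) (cubicClass_neg_one hF), mul_neg_one]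

theorem classSum_zero_class (c : F) : classSum ψ f 0 c = 1 := by
  simp [classSum, filter_cubicClass_zero]

theorem sum_classSum (hψ : ψ.IsPrimitive) (c : F) :
    ∑ i, classSum ψ f i c = if c = 0 then (Fintype.card F : ℂ) else 0 := by
  unfold classSum
  rw [Finset.sum_fiberwise_of_maps_to (fun _ _ => by simp)]
  simp_rw [mul_comm c]
  rw [AddChar.sum_mulShift c hψ]
  split_ifs <;> simp

/-- The product of class sums over all dilations counts solutions of `x + y = z`. -/
theorem sum_classSum_mul_mul (hF : Fintype.card F = 3 * f + 1) (hψ : ψ.IsPrimitive)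
    (i j k : Fin 3) :
    ∑ c, classSum ψ f i c * classSum ψ f j c * classSum ψ f k c =
      (Fintype.card F : ℂ) * #{u : F × F | cubicClass f u.1 = i ∧ cubicClass f u.2 = j ∧
        cubicClass f (u.1 + u.2) = k} := by
  have key (c : F) : classSum ψ f i c * classSum ψ f j c * classSum ψ f k c =
      ∑ x with cubicClass f x = i, ∑ y with cubicClass f y = j, ∑ z with cubicClass f z = k,
        ψ (c * (x + y - z)) := by
    rw [← classSum_neg hF k c]
    simp only [classSum]
    rw [Finset.sum_mul_sum]
    simp_rw [Finset.sum_mul, Finset.mul_sum]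
    refine Finset.sum_congr rfl fun x _ => Finset.sum_congr rfl fun y _ =>
      Finset.sum_congr rfl fun z _ => ?_
    rw [← AddChar.map_add_eq_mul, ← AddChar.map_add_eq_mul]
    ring_nf
  simp_rw [key]
  rw [Finset.sum_comm]
  simp_rw [Finset.sum_comm (s := univ (α := F))]
  simp_rw [AddChar.sum_mulShift _ hψ]
  rw [Finset.card_filter, ← Finset.univ_product_univ, Finset.sum_product]
  push_cast
  simp only [Finset.sum_filter, Finset.mul_sum, sub_eq_zero]
  refine Finset.sum_congr rfl fun x _ => ?_
  by_cases hx : cubicClass f x = i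
  · simp only [hx, if_true, true_and]
    refine Finset.sum_congr rfl fun y _ => ?_
    by_cases hy : cubicClass f y = j
    · simp only [hy, if_true, true_and]
      rw [Finset.sum_eq_single (x + y)] <;> simp +contextual [eq_comm]
    · simp [hy]
  · simp [hx]

end ClassSum

section Period

variable {F : Type} [Field F] [Fintype F] {f : ℕ} {ψ : AddChar F ℂ}

/-- The cubic Gaussian periods in the semiprimitive case, together with the value at zero. -/
noncomputable def cubicPeriod (f : ℕ) (ε : ℝ) : Fin 3 → ℝ :=
  ![f, (-1 - 2 * ε) / 3, (-1 + ε) / 3]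

theorem classSum_pow_char {p : ℕ} [CharP F p] (hp : p.Prime) (hp3 : p % 3 = 2)
    (hF : Fintype.card F = 3 * f + 1) (hfrob : ∀ x, ψ (x ^ p) = ψ x) (i : Fin 3) (c : F) :
    classSum ψ f i (c ^ p) = classSum ψ f i c := by
  have := Fact.mk hp
  symm
  refine Finset.sum_bijective (fun x => x ^ p)
    (Finite.injective_iff_bijective.1 (frobenius_inj F p)) ?_ ?_
  · intro x
    have : (x ^ f) ^ 3 = 1 ∨ x = 0 :=
      (em (x = 0)).symm.imp_left fun hx => pow_third_pow_three hF hx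
    simp [cubicClass_pow_of_coprime hp.ne_zero hp3 this]
  · intro x _
    rw [← mul_pow, hfrob]

theorem classSum_eq_of_pow_eq {i : Fin 3} {c d : F} (hc : c ≠ 0) (hd : d ≠ 0)
    (h : c ^ f = d ^ f) : classSum ψ f i c = classSum ψ f i d := by
  have : cubicClass f (c / d) = 1 :=
    cubicClass_eq_one_iff.2 ⟨div_ne_zero hc hd, by rw [div_pow, h, div_self (pow_ne_zero _ hd)]⟩
  rw [← classSum_mul (c := d) this, mul_div_cancel₀ _ hd]

theorem sum_classSum_one (hF : Fintype.card F = 3 * f + 1) (hψ : ψ.IsPrimitive) :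
    ∑ c, classSum ψ f 1 c = 0 := by
  have h := sum_classSum_mul_mul hF hψ 1 0 0
  simp only [classSum_zero_class, mul_one] at h
  rw [h, Finset.filter_eq_empty_iff.2, card_empty, Nat.cast_zero, mul_zero]
  rintro ⟨x, y⟩ - ⟨hx, hy, hxy⟩
  simp only [cubicClass_eq_zero_iff] at hy hxy
  simp only [hy, add_zero] at hxy
  simp [hxy, cubicClass] at hx

theorem sum_classSum_one_sq (hF : Fintype.card F = 3 * f + 1) (hψ : ψ.IsPrimitive) :
    ∑ c, classSum ψ f 1 c ^ 2 = (3 * f + 1) * f := by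
  have h := sum_classSum_mul_mul hF hψ 1 0 1
  simp only [classSum_zero_class, mul_one, ← sq] at h
  have hcard : #{u : F × F | cubicClass f u.1 = 1 ∧ cubicClass f u.2 = 0 ∧
      cubicClass f (u.1 + u.2) = 1} = #{x : F | cubicClass f x = 1} := by
    symm
    refine Finset.card_bij (fun x _ => (x, 0)) ?_ ?_ ?_
    · simp +contextual [cubicClass_eq_zero_iff]
    · simp
    · rintro ⟨x, y⟩ hxy
      simp only [cubicClass_eq_zero_iff, mem_filter_univ] at hxy
      exact ⟨x, by simpa using hxy.1, by simp [hxy.2.1]⟩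
  rw [h, hcard, card_cubicClass_one hF, hF]
  push_cast; ring

theorem isIntegral_classSum (i : Fin 3) (c : F) : IsIntegral ℤ (classSum ψ f i c) := by
  refine IsIntegral.sum _ fun x _ => ?_
  refine IsIntegral.of_pow (n := Fintype.card F) Fintype.card_pos ?_
  rw [← AddChar.map_nsmul_eq_pow, card_nsmul_eq_zero, AddChar.map_zero_eq_one]
  exact isIntegral_one

theorem three_dvd_of_isIntegral {k : ℤ} {z : ℂ} (hz : IsIntegral ℤ z) (h : 3 * z = k) :
    (3 : ℤ) ∣ k := by
  have hz' : z = algebraMap ℚ ℂ ((k : ℚ) / 3) := by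
    rw [eq_ratCast]; push_cast; rw [← h]; ring
  rw [hz', isIntegral_algebraMap_iff (algebraMap ℚ ℂ).injective,
    IsIntegrallyClosed.isIntegral_iff] at hz
  obtain ⟨y, hy⟩ := hz
  refine ⟨y, ?_⟩
  have : (k : ℚ) = 3 * y := by
    rw [eq_intCast] at hy; rw [hy]; ring
  exact_mod_cast this

/-- Evaluation of the cubic Gaussian periods for `p ≡ 2 (mod 3)`. -/
theorem classSum_one_eq_cubicPeriod {p : ℕ} [CharP F p] (hp : p.Prime) (hp3 : p % 3 = 2)
    (hF : Fintype.card F = 3 * f + 1) (hf : f ≠ 0) (hψ : ψ.IsPrimitive)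
    (hfrob : ∀ x, ψ (x ^ p) = ψ x) {ε : ℤ} (hε : ε ^ 2 = 3 * f + 1) (hε3 : (3 : ℤ) ∣ ε - 1)
    (c : F) : classSum ψ f 1 c = (cubicPeriod f ε (cubicClass f c) : ℝ) := by
  obtain ⟨a, ha⟩ : ∃ a : F, cubicClass f a = 2 := by
    have h : 0 < #{x : F | cubicClass f x = 2} := by
      rw [card_cubicClass_two hF]; omega
    obtain ⟨a, ha⟩ := Finset.card_pos.1 h
    exact ⟨a, by simpa using ha⟩
  have ha0 : a ≠ 0 := by rintro rfl; simp [cubicClass] at ha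
  have ha1 : a ^ f ≠ 1 := fun h => by simp [cubicClass, ha0, h] at ha
  have ha3 := pow_third_pow_three hF ha0
  have haω : (a ^ f) ^ 2 + a ^ f + 1 = 0 := by
    apply mul_left_cancel₀ (sub_ne_zero.2 ha1)
    linear_combination ha3
  have hG (c : F) : classSum ψ f 1 c =
      ![(f : ℂ), classSum ψ f 1 (1 : F), classSum ψ f 1 a] (cubicClass f c) := by
    by_cases hc0 : c = 0
    · have : classSum ψ f 1 (0 : F) = f := by simp [classSum, card_cubicClass_one hF]
      rw [hc0, this]
      simp [cubicClass]
    by_cases hc1 : c ^ f = 1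
    · rw [classSum_eq_of_pow_eq hc0 one_ne_zero (by simpa using hc1)]
      simp [cubicClass, hc0, hc1]
    have hc3 := pow_third_pow_three hF hc0
    have hc : (c ^ f - a ^ f) * (c ^ f - (a ^ f) ^ 2) = 0 := by
      apply mul_left_cancel₀ (sub_ne_zero.2 hc1)
      linear_combination hc3 - ha3 + (c ^ f - 1) * (ha3 - c ^ f * haω) + ha3
    have : classSum ψ f 1 c = classSum ψ f 1 a := by
      rcases mul_eq_zero.1 hc with h | h
      · exact classSum_eq_of_pow_eq hc0 ha0 (sub_eq_zero.1 h)
      · rw [← classSum_pow_char hp hp3 hF hfrob 1 a]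
        refine classSum_eq_of_pow_eq hc0 (pow_ne_zero _ ha0) ?_
        rw [sub_eq_zero.1 h, ← pow_mul a p f, mul_comm p, pow_mul a f p]
        conv_rhs => rw [← Nat.div_add_mod p 3, hp3, pow_add, pow_mul, ha3, one_pow, one_mul]
    rw [this]
    simp [cubicClass, hc0, hc1]
  have hf' : (f : ℂ) ≠ 0 := Nat.cast_ne_zero.2 hf
  have h1 := (Finset.sum_congr rfl fun c _ => (hG c).symm).trans (sum_classSum_one hF hψ)
  have h2 := (Finset.sum_congr rfl fun c _ => (congrArg (· ^ 2) (hG c)).symm).trans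
    (sum_classSum_one_sq hF hψ)
  have hint := isIntegral_classSum (ψ := ψ) (f := f) 1 a
  rw [sum_comp_cubicClass hF] at h1
  rw [sum_comp_cubicClass hF (fun i => ![(f : ℂ), classSum ψ f 1 (1 : F), classSum ψ f 1 a] i ^ 2)]
    at h2
  rw [hG c]
  generalize classSum ψ f 1 (1 : F) = A at *
  generalize classSum ψ f 1 a = B at *
  simp only [Matrix.cons_val] at h1 h2
  have hA : A = -1 - 2 * B := by
    apply mul_left_cancel₀ hf'
    linear_combination h1
  have hεC : (ε : ℂ) ^ 2 = 3 * f + 1 := by exact_mod_cast hε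
  have hB : (3 * B + 1 - ε) * (3 * B + 1 + ε) = 0 := by
    apply mul_left_cancel₀ hf'
    subst hA
    linear_combination (3 / 2) * h2 - f * hεC
  have hB' : B = (-1 + ε) / 3 := by
    rcases mul_eq_zero.1 hB with h | h
    · linear_combination h / 3
    · have := three_dvd_of_isIntegral (k := -1 - ε) hint (by push_cast; linear_combination h)
      omega
  generalize cubicClass f c = i
  fin_cases i <;> simp [cubicPeriod, hA, hB']
  ring

end Period

section TripleCount

variable {F : Type} [Field F] [Fintype F] {f : ℕ} {ψ : AddChar F ℂ}

theorem card_cubicClass_triple (hF : Fintype.card F = 3 * f + 1) {β : F}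
    (hβ : β ^ 2 + β + 1 = 0) (hβ1 : β ≠ 1) (hβc : cubicClass f β = 1) (i j k : Fin 3) :
    #{ab : F × F | cubicClass f (ab.1 + ab.2) = i ∧ cubicClass f (ab.1 + ab.2 * β) = j ∧
        cubicClass f (ab.1 + ab.2 * β ^ 2) = k} =
      #{u : F × F | cubicClass f u.1 = i ∧ cubicClass f u.2 = j ∧
        cubicClass f (u.1 + u.2) = k} := by
  have hβ0 := (cubicClass_eq_one_iff.1 hβc).1
  refine Finset.card_bijective (fun ab => (ab.1 + ab.2, (ab.1 + ab.2 * β) * β))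
    (Finite.injective_iff_bijective.1 ?_) ?_
  · rintro ⟨a, b⟩ ⟨a', b'⟩ h
    obtain ⟨h1, h2⟩ := Prod.mk.injEq .. ▸ h
    have h2 := mul_right_cancel₀ hβ0 h2
    have hb : b = b' := by
      apply mul_right_cancel₀ (sub_ne_zero.2 hβ1)
      linear_combination h2 - h1
    subst hb
    simpa using h1
  · rintro ⟨a, b⟩
    have : a + b + (a + b * β) * β = -((a + b * β ^ 2) * β * β) := by
      linear_combination (a + b * (β ^ 2 - β + 1)) * hβ
    simp [this, cubicClass_neg hF, cubicClass_mul hβc]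

/-- The values of the character sums of the cubic classes: the row is the class summed over,
the column the class of the dilation. -/
noncomputable def classSumTable (f : ℕ) (ε : ℝ) (i t : Fin 3) : ℝ :=
  ![1, cubicPeriod f ε t, (if t = 0 then 3 * f + 1 else 0) - 1 - cubicPeriod f ε t] i

theorem classSum_eq_classSumTable (hF : Fintype.card F = 3 * f + 1) (hψ : ψ.IsPrimitive) {ε : ℝ}
    (hper : ∀ c, classSum ψ f 1 c = (cubicPeriod f ε (cubicClass f c) : ℝ)) (i : Fin 3) (c : F) :
    classSum ψ f i c = (classSumTable f ε i (cubicClass f c) : ℝ) := by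
  have h := sum_classSum (f := f) hψ c
  rw [Fin.sum_univ_three, classSum_zero_class, hper, hF] at h
  fin_cases i
  · simp [classSumTable, classSum_zero_class]
  · simp [classSumTable, hper]
  · simp only [Fin.reduceFinMk, classSumTable, Matrix.cons_val, cubicClass_eq_zero_iff]
    split_ifs at h ⊢ <;> push_cast at h ⊢ <;> linear_combination h

/-- The number of solutions of `x + y = z` with `x`, `y`, `z` in prescribed cubic classes. -/
noncomputable def tripleFreq (f : ℕ) (ε : ℝ) (i j k : Fin 3) : ℝ :=
  (classSumTable f ε i 0 * classSumTable f ε j 0 * classSumTable f ε k 0 +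
    f * (classSumTable f ε i 1 * classSumTable f ε j 1 * classSumTable f ε k 1) +
    2 * f * (classSumTable f ε i 2 * classSumTable f ε j 2 * classSumTable f ε k 2)) / (3 * f + 1)

theorem card_solutions_eq_tripleFreq (hF : Fintype.card F = 3 * f + 1) (hψ : ψ.IsPrimitive) {ε : ℝ}
    (hper : ∀ c, classSum ψ f 1 c = (cubicPeriod f ε (cubicClass f c) : ℝ)) (i j k : Fin 3) :
    (#{u : F × F | cubicClass f u.1 = i ∧ cubicClass f u.2 = j ∧
        cubicClass f (u.1 + u.2) = k} : ℝ) = tripleFreq f ε i j k := by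
  have h := sum_classSum_mul_mul hF hψ i j k
  simp_rw [classSum_eq_classSumTable hF hψ hper] at h
  rw [sum_comp_cubicClass hF fun t => (classSumTable f ε i t : ℂ) * (classSumTable f ε j t : ℝ) *
    (classSumTable f ε k t : ℝ), hF] at h
  have h0 : (3 * f + 1 : ℝ) ≠ 0 := by positivity
  rw [tripleFreq, eq_div_iff h0, mul_comm]
  exact_mod_cast h.symm

theorem sum_tripleFreq_ite {r : ℝ} {f : ℕ} {ε : ℝ} (hr : r = 3 * f + 1) (hε : ε ^ 2 = r)
    (h q x : ℝ) :
    ∑ i, ∑ j, ∑ k, (if h / q * (cubicPeriod f ε i + cubicPeriod f ε j + cubicPeriod f ε k) = x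
      then tripleFreq f ε i j k else 0) =
        (if -(h * (2 * ε + 1)) / q = x then (r - 1) * (r - 8 - 2 * ε) / 27 else 0) +
        (if h * (ε - 1) / q = x then 2 * (r - 1) * (4 * r - 14 + ε) / 27 else 0) +
        (if -(h * (ε + 1)) / q = x then 2 * (r - 1) * (r - 2 + ε) / 9 else 0) +
        (if -h / q = x then 2 * (r - 1) * (2 * r - 1 - ε) / 9 else 0) +
        (if h * (r - 4 * ε - 3) / (3 * q) = x then r - 1 else 0) +
        (if h * (r + 2 * ε - 3) / (3 * q) = x then 2 * (r - 1) else 0) +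
        (if h * (r - 1) / q = x then 1 else 0) := by
  have hr0 : r ≠ 0 := by rw [hr]; positivity
  have hε0 : ε ≠ 0 := by rintro rfl; simp at hε; exact hr0 hε.symm
  obtain ⟨P, hP⟩ : ∃ P : ℝ → ℝ, P = fun v => if v = x then 1 else 0 := ⟨_, rfl⟩
  have hite (v y : ℝ) : (if v = x then y else 0) = y * P v := by simp [hP]
  simp only [hite]
  have hf : (f : ℝ) = (ε ^ 2 - 1) / 3 := by rw [hε, hr]; ring
  subst hε
  have v1 : -(h * (2 * ε + 1)) / q = h / q * (-(2 * ε + 1)) := by ring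
  have v2 : h * (ε - 1) / q = h / q * (ε - 1) := by ring
  have v3 : -(h * (ε + 1)) / q = h / q * (-(ε + 1)) := by ring
  have v4 : -h / q = h / q * (-1) := by ring
  have v5 : h * (ε ^ 2 - 4 * ε - 3) / (3 * q) = h / q * ((ε ^ 2 - 4 * ε - 3) / 3) := by
    ring
  have v6 : h * (ε ^ 2 + 2 * ε - 3) / (3 * q) = h / q * ((ε ^ 2 + 2 * ε - 3) / 3) := by
    ring
  have v7 : h * (ε ^ 2 - 1) / q = h / q * (ε ^ 2 - 1) := by ring
  rw [v1, v2, v3, v4, v5, v6, v7]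
  generalize h / q = C
  obtain ⟨T, hT⟩ : ∃ T : Fin 3 → Fin 3 → Fin 3 → ℝ, T = fun i j k => tripleFreq f ε i j k *
    P (C * (cubicPeriod f ε i + cubicPeriod f ε j + cubicPeriod f ε k)) := ⟨_, rfl⟩
  have hswap (i j k) : T i j k = T j i k := by
    simp only [hT, tripleFreq, add_comm (cubicPeriod f ε i)]; ring
  have hswap' (i j k) : T i j k = T i k j := by
    simp only [hT, tripleFreq, add_right_comm _ (cubicPeriod f ε j)]; ring
  have heval {i j k v n} (hv : cubicPeriod f ε i + cubicPeriod f ε j + cubicPeriod f ε k = v)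
      (hn : tripleFreq f ε i j k = n) : T i j k = n * P (C * v) := by
    simp only [hT, hv, hn]
  have h000 : T 0 0 0 = 1 * P (C * (ε ^ 2 - 1)) := by
    apply heval <;> simp [tripleFreq, classSumTable, cubicPeriod, hf] <;> field_simp <;> ring
  have h001 : T 0 0 1 = 0 := by
    simp [hT, tripleFreq, classSumTable, cubicPeriod, hf]
    left; left; ring
  have h002 : T 0 0 2 = 0 := by
    simp [hT, tripleFreq, classSumTable, cubicPeriod, hf]
    left; left; ring
  have h012 : T 0 1 2 = 0 := by
    simp [hT, tripleFreq, classSumTable, cubicPeriod, hf]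
    left; left; ring
  have h011 : T 0 1 1 = ((ε ^ 2 - 1) / 3) * P (C * ((ε ^ 2 - 4 * ε - 3) / 3)) := by
    apply heval <;> simp [tripleFreq, classSumTable, cubicPeriod, hf] <;> field_simp <;> ring
  have h022 : T 0 2 2 = (2 * (ε ^ 2 - 1) / 3) * P (C * ((ε ^ 2 + 2 * ε - 3) / 3)) := by
    apply heval <;> simp [tripleFreq, classSumTable, cubicPeriod, hf] <;> field_simp <;> ring
  have h111 : T 1 1 1 = ((ε ^ 2 - 1) * (ε ^ 2 - 8 - 2 * ε) / 27) * P (C * (-(2 * ε + 1))) := by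
    apply heval <;> simp [tripleFreq, classSumTable, cubicPeriod, hf] <;> field_simp <;> ring
  have h112 : T 1 1 2 = (2 * (ε ^ 2 - 1) * (ε ^ 2 - 2 + ε) / 27) * P (C * (-(ε + 1))) := by
    apply heval <;> simp [tripleFreq, classSumTable, cubicPeriod, hf] <;> field_simp <;> ring
  have h122 : T 1 2 2 = (2 * (ε ^ 2 - 1) * (2 * ε ^ 2 - 1 - ε) / 27) * P (C * (-1)) := by
    apply heval <;> simp [tripleFreq, classSumTable, cubicPeriod, hf] <;> field_simp <;> ring
  have h222 : T 2 2 2 = (2 * (ε ^ 2 - 1) * (4 * ε ^ 2 - 14 + ε) / 27) * P (C * (ε - 1)) := by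
    apply heval <;> simp [tripleFreq, classSumTable, cubicPeriod, hf] <;> field_simp <;> ring
  have hsum : ∑ i, ∑ j, ∑ k, T i j k = T 0 0 0 + T 1 1 1 + T 2 2 2 + 3 * T 0 0 1 + 3 * T 0 0 2 +
      3 * T 0 1 1 + 3 * T 0 2 2 + 3 * T 1 1 2 + 3 * T 1 2 2 + 6 * T 0 1 2 := by
    simp only [Fin.sum_univ_three]
    rw [hswap' 0 1 0, hswap' 0 2 0, hswap' 0 2 1, hswap 1 0 0, hswap' 0 1 0, hswap 1 0 1,
      hswap 1 0 2, hswap' 1 1 0, hswap 1 0 1, hswap' 1 2 0, hswap 1 0 2, hswap' 1 2 1,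
      hswap 2 0 0, hswap' 0 2 0, hswap 2 0 1, hswap' 0 2 1, hswap 2 0 2, hswap 2 1 0,
      hswap' 1 2 0, hswap 1 0 2, hswap 2 1 1, hswap' 1 2 1, hswap 2 1 2, hswap' 2 2 0,
      hswap 2 0 2, hswap' 2 2 1, hswap 2 1 2]
    ring
  rw [h000, h001, h002, h012, h011, h022, h111, h112, h122, h222, hT] at hsum
  rw [hsum]
  ring

end TripleCount

theorem trace_pow_char {K F : Type} [Field K] [Field F] [Algebra K F] [Finite F]
    (p : ℕ) (hp : p.Prime) [CharP F p] (x : F) :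
    Algebra.trace K F (x ^ p) = Algebra.trace K F x ^ p := by
  have := Fact.mk hp
  apply (algebraMap K F).injective
  rw [map_pow (algebraMap K F), FiniteField.algebraMap_trace_eq_sum_pow,
    FiniteField.algebraMap_trace_eq_sum_pow,
    sum_pow_char]
  simp_rw [← pow_mul, mul_comm]

section TraceCharacter

variable {K F : Type} [Field K] [Field F] [Algebra K F] [Fintype K]

theorem exists_primitive_frobenius_invariant (p : ℕ) (hp : p.Prime) [CharP K p] :
    ∃ φ : AddChar K ℂ, φ.IsPrimitive ∧ ∀ x, φ (x ^ p) = φ x := by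
  have := Fact.mk hp
  let : Algebra (ZMod p) K := ZMod.algebra K p
  refine ⟨ZMod.stdAddChar.compAddMonoidHom (Algebra.trace (ZMod p) K).toAddMonoidHom,
    AddChar.IsPrimitive.of_ne_one ?_, fun x => ?_⟩
  · obtain ⟨a, ha⟩ := Algebra.trace_surjective (ZMod p) K 1
    refine AddChar.ne_one_iff.2 ⟨a, fun h => one_ne_zero (α := ZMod p) ?_⟩
    rw [← ha]
    apply ZMod.injective_stdAddChar
    simpa using h
  · have h := Algebra.trace_eq_of_algEquiv
      (FiniteField.frobeniusAlgEquivOfAlgebraic (ZMod p) K) x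
    rw [FiniteField.coe_frobeniusAlgEquivOfAlgebraic, ZMod.card] at h
    simp [h]

variable [Fintype F] in
theorem isPrimitive_comp_trace {φ : AddChar K ℂ} (hφ : φ.IsPrimitive) :
    (φ.compAddMonoidHom (Algebra.trace K F).toAddMonoidHom).IsPrimitive := by
  have : φ ≠ 1 := by
    have := hφ one_ne_zero
    rwa [AddChar.mulShift_one] at this
  obtain ⟨t, ht⟩ := AddChar.ne_one_iff.1 this
  obtain ⟨a, rfl⟩ := Algebra.trace_surjective K F t
  exact AddChar.IsPrimitive.of_ne_one (AddChar.ne_one_iff.2 ⟨a, by simpa using ht⟩)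

theorem sum_eq_zero_add_sum_units (G : K → ℂ) : ∑ y, G y = G 0 + ∑ y : Kˣ, G y := by
  rw [← Finset.add_sum_erase univ G (mem_univ 0)]
  congr 1
  symm
  refine Finset.sum_bij (fun u _ => (u : K)) (by simp) (fun _ _ _ _ h => Units.ext h) ?_ (by simp)
  intro b hb
  exact ⟨Units.mk0 b (by simpa using hb), mem_univ _, rfl⟩

theorem card_mul_card_trace_eq_zero {φ : AddChar K ℂ} (hφ : φ.IsPrimitive) (n : ℕ) (w : ℕ → F) :
    (Fintype.card K : ℂ) * #{i ∈ range n | Algebra.trace K F (w i) = 0} =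
      n + ∑ i ∈ range n, ∑ y : Kˣ, φ (Algebra.trace K F (w i * algebraMap K F y)) := by
  have key (i : ℕ) : (if Algebra.trace K F (w i) = 0 then (Fintype.card K : ℂ) else 0) =
      1 + ∑ y : Kˣ, φ (Algebra.trace K F (w i * algebraMap K F y)) := by
    have h := AddChar.sum_mulShift (Algebra.trace K F (w i)) hφ
    rw [sum_eq_zero_add_sum_units, zero_mul, AddChar.map_zero_eq_one] at h
    push_cast at h
    rw [← h]
    congr 1
    refine Finset.sum_congr rfl fun y _ => ?_
    rw [mul_comm (w i), ← Algebra.smul_def, map_smul, smul_eq_mul]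
  rw [Finset.card_filter]
  push_cast
  rw [Finset.mul_sum]
  simp_rw [mul_ite, mul_one, mul_zero, key, Finset.sum_add_distrib]
  simp

variable [Fintype F] {f : ℕ} {ψ : AddChar F ℂ}

theorem exists_eq_zpow_three {α : Fˣ} (hα : ∀ x : Fˣ, x ∈ Subgroup.zpowers α)
    (hF : Fintype.card F = 3 * f + 1) (hf : f ≠ 0) {x : Fˣ} (hx : x ^ f = 1) :
    x ∈ Subgroup.zpowers (α ^ 3) := by
  obtain ⟨j, rfl⟩ := hα x
  have ho : orderOf α = 3 * f := by
    rw [orderOf_eq_card_of_forall_mem_zpowers hα, Nat.card_eq_fintype_card, Fintype.card_units, hF,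
      Nat.add_sub_cancel]
  have hx : α ^ (j * f) = 1 := by
    rw [zpow_mul]; exact_mod_cast hx
  have hd := orderOf_dvd_iff_zpow_eq_one.2 hx
  rw [ho, Nat.cast_mul] at hd
  obtain ⟨t, rfl⟩ : (3 : ℤ) ∣ j := Int.dvd_of_mul_dvd_mul_right (by exact_mod_cast hf) hd
  exact ⟨t, by simp [zpow_mul]⟩

/-- Averaging over the units of `K` and the powers of `α ^ D` averages over the cubes. -/
theorem sum_units_sum_pow {α : Fˣ} (hα : ∀ x : Fˣ, x ∈ Subgroup.zpowers α)
    (hF : Fintype.card F = 3 * f + 1) (hf : f ≠ 0) {M D l h : ℕ} {κ : Kˣ}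
    (hκ : algebraMap K F κ = (α : F) ^ M) (hgcd : Nat.gcd M D = 3)
    (hKf : Fintype.card K - 1 ∣ f) (hD : (α : F) ^ (D * l) = 1)
    (hl : (Fintype.card K - 1) * l = h * f) (c : F) :
    ∑ y : Kˣ, ∑ k ∈ range l, ψ (c * (algebraMap K F y * (α : F) ^ (D * k))) =
      h * classSum ψ f 1 c := by
  obtain ⟨S, hS⟩ : ∃ S : F → ℂ, S = fun c => ∑ y : Kˣ, ∑ k ∈ range l,
    ψ (c * (algebraMap K F y * (α : F) ^ (D * k))) := ⟨_, rfl⟩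
  let H : Subgroup Fˣ :=
    { carrier := {t | ∀ c, S (c * t) = S c}
      mul_mem' := fun {s t} hs ht c => by
        rw [Units.val_mul, ← mul_assoc, ht, hs]
      one_mem' := fun c => by simp
      inv_mem' := fun {t} ht c => by
        rw [← ht]; simp }
  have hMmem : α ^ M ∈ H := fun c => by
    simp only [hS]
    refine Fintype.sum_equiv (Equiv.mulLeft κ) _ _ fun y => Finset.sum_congr rfl fun k _ => ?_
    simp [hκ, mul_assoc]
  have hDmem : α ^ D ∈ H := fun c => by
    simp only [hS]
    refine Finset.sum_congr rfl fun y _ => ?_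
    let G : ℕ → ℂ := fun k => ψ (c * (algebraMap K F y * (α : F) ^ (D * k)))
    have h1 := Finset.sum_range_succ G l
    have h2 := Finset.sum_range_succ' G l
    have h3 : G l = G 0 := by simp [G, hD]
    rw [h1, h3] at h2
    refine Eq.trans (Finset.sum_congr rfl fun k _ => ?_) (add_right_cancel h2).symm
    simp only [G]
    congr 1
    push_cast
    ring
  have h3mem : α ^ 3 ∈ H := by
    rw [← zpow_natCast, ← hgcd, Nat.gcd_eq_gcd_ab, zpow_add, zpow_mul, zpow_mul]
    exact H.mul_mem (H.zpow_mem (by simpa using hMmem) _) (H.zpow_mem (by simpa using hDmem) _)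
  have hcube (x : F) (hx : cubicClass f x = 1) : S (c * x) = S c := by
    obtain ⟨hx0, hx1⟩ := cubicClass_eq_one_iff.1 hx
    have : Units.mk0 x hx0 ∈ H := by
      refine (Subgroup.zpowers_le.2 h3mem) (exists_eq_zpow_three hα hF hf ?_)
      ext; simpa using hx1
    exact this c
  have hsum1 : ∑ x : F with cubicClass f x = 1, S (c * x) = f * S c := by
    rw [Finset.sum_congr rfl (g := fun _ => S c) fun x hx => hcube x (by simpa using hx)]
    simp [card_cubicClass_one hF]
  have hsum2 : ∑ x : F with cubicClass f x = 1, S (c * x) =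
      (Fintype.card K - 1 : ℕ) * (l * classSum ψ f 1 c) := by
    simp only [hS]
    rw [Finset.sum_comm]
    simp_rw [Finset.sum_comm (s := ({x : F | cubicClass f x = 1} : Finset F))]
    have (y : Kˣ) (k : ℕ) : ∑ x : F with cubicClass f x = 1,
        ψ (c * x * (algebraMap K F y * (α : F) ^ (D * k))) = classSum ψ f 1 c := by
      have hcl : cubicClass f (algebraMap K F y * (α : F) ^ (D * k)) = 1 := by
        refine cubicClass_eq_one_iff.2 ⟨by simp, ?_⟩
        obtain ⟨u, hu⟩ := hKf
        obtain ⟨v, hv⟩ : 3 ∣ D := hgcd ▸ Nat.gcd_dvd_right M D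
        have h1 : (algebraMap K F y) ^ f = 1 := by
          rw [hu, ← map_pow, pow_mul, FiniteField.pow_card_sub_one_eq_one _ y.ne_zero]; simp
        have h2 : ((α : F) ^ (D * k)) ^ f = 1 := by
          rw [← pow_mul, hv, show 3 * v * k * f = f * 3 * (v * k) by ring, pow_mul, pow_mul (α : F),
            pow_third_pow_three hF α.ne_zero, one_pow]
        rw [mul_pow, h1, h2, one_mul]
      rw [← classSum_mul hcl]
      refine Finset.sum_congr rfl fun x _ => ?_
      ring_nf
    simp [this, Fintype.card_units]
  have hf' : (f : ℂ) ≠ 0 := Nat.cast_ne_zero.2 hf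
  have hl' : ((Fintype.card K - 1 : ℕ) : ℂ) * l = h * f := by exact_mod_cast hl
  have hmain : S c = h * classSum ψ f 1 c := by
    apply mul_left_cancel₀ hf'
    rw [← hsum1, hsum2, ← mul_assoc, hl']
    ring
  rw [← hmain, hS]

theorem sum_range_three_mul (G : ℕ → ℂ) (l : ℕ) :
    ∑ i ∈ range (3 * l), G i =
      ∑ k ∈ range l, G (3 * k) + ∑ k ∈ range l, G (3 * k + 1) + ∑ k ∈ range l, G (3 * k + 2) := by
  induction l with
  | zero => simp
  | succ l ih =>
    rw [show 3 * (l + 1) = 3 * l + 1 + 1 + 1 by ring]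
    simp only [Finset.sum_range_succ, ih]
    ring

end TraceCharacter

section CodeWeight

variable {K F : Type} [Field K] [Field F] [Algebra K F] [Fintype K] [Fintype F] {f : ℕ}

/-- The number of zero coordinates of a codeword in terms of cubic Gaussian periods. -/
theorem card_mul_card_zero_coords {φ : AddChar K ℂ} (hφ : φ.IsPrimitive) {ψ : AddChar F ℂ}
    (hψ : ∀ x, ψ x = φ (Algebra.trace K F x)) {α : Fˣ} (hα : ∀ x : Fˣ, x ∈ Subgroup.zpowers α)
    (hF : Fintype.card F = 3 * f + 1) (hf : f ≠ 0) {M d l h : ℕ} {κ : Kˣ}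
    (hκ : algebraMap K F κ = (α : F) ^ M) (hgcd : Nat.gcd M (3 * d) = 3) (hd : 3 ∣ d)
    (hKf : Fintype.card K - 1 ∣ f) (hdl : d * l = f) (hl : (Fintype.card K - 1) * l = h * f)
    {g β : F} (hg : g = (α : F) ^ d) (hβ : β ^ 3 = 1) (a b : F) :
    (Fintype.card K : ℂ) *
        #{i ∈ range (3 * l) | Algebra.trace K F (a * g ^ i + b * (β * g) ^ i) = 0} =
      (3 * l : ℕ) + h * (classSum ψ f 1 (a + b) + classSum ψ f 1 (a + b * β) +
        classSum ψ f 1 (a + b * β ^ 2)) := by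
  have hα3 := pow_third_pow_three hF α.ne_zero
  have hgc : cubicClass f g = 1 := by
    refine cubicClass_eq_one_iff.2 ⟨by simp [hg], ?_⟩
    obtain ⟨v, rfl⟩ := hd
    rw [hg, ← pow_mul, show 3 * v * f = f * 3 * v by ring, pow_mul, pow_mul (α : F), hα3, one_pow]
  have hD : (α : F) ^ (3 * d * l) = 1 := by
    rw [mul_assoc, hdl, mul_comm, pow_mul, hα3]
  have hpart (j : ℕ) : ∑ k ∈ range l, ∑ y : Kˣ,
      φ (Algebra.trace K F ((a * g ^ (3 * k + j) + b * (β * g) ^ (3 * k + j)) *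
        algebraMap K F y)) = h * classSum ψ f 1 ((a + b * β ^ j) * g ^ j) := by
    rw [Finset.sum_comm, ← sum_units_sum_pow hα hF hf hκ hgcd hKf hD hl]
    refine Finset.sum_congr rfl fun y _ => Finset.sum_congr rfl fun k _ => ?_
    rw [← hψ]
    congr 1
    have h1 : g ^ (3 * k + j) = g ^ j * (α : F) ^ (3 * d * k) := by
      rw [hg]; ring
    have h2 : β ^ (3 * k + j) = β ^ j := by rw [pow_add, pow_mul, hβ, one_pow, one_mul]
    rw [mul_pow, h1, h2]
    ring
  rw [card_mul_card_trace_eq_zero hφ, sum_range_three_mul]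
  have h0 := hpart 0
  simp only [add_zero, pow_zero, mul_one] at h0
  rw [h0, hpart 1, hpart 2, pow_one, pow_one, classSum_mul hgc, pow_two g, ← mul_assoc,
    classSum_mul hgc, classSum_mul hgc]
  ring

theorem card_lam_eq {ψ : AddChar F ℂ} (hF : Fintype.card F = 3 * f + 1) (hψ : ψ.IsPrimitive)
    {ε : ℝ} (hper : ∀ c, classSum ψ f 1 c = (cubicPeriod f ε (cubicClass f c) : ℝ)) {β : F}
    (hβ : β ^ 2 + β + 1 = 0) (hβ1 : β ≠ 1) (hβc : cubicClass f β = 1) {lam : F → F → ℝ} {C : ℝ}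
    (hlam : ∀ a b, lam a b = C * (cubicPeriod f ε (cubicClass f (a + b)) +
      cubicPeriod f ε (cubicClass f (a + b * β)) +
      cubicPeriod f ε (cubicClass f (a + b * β ^ 2)))) (x : ℝ) :
    (Set.ncard {ab : F × F | lam ab.1 ab.2 = x} : ℝ) =
      ∑ i, ∑ j, ∑ k, (if C * (cubicPeriod f ε i + cubicPeriod f ε j + cubicPeriod f ε k) = x
        then tripleFreq f ε i j k else 0) := by
  have hset : {ab : F × F | lam ab.1 ab.2 = x} =
      (({ab : F × F | lam ab.1 ab.2 = x} : Finset (F × F)) : Set (F × F)) := by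
    ext; simp
  rw [hset, Set.ncard_coe_finset, Finset.card_eq_sum_card_fiberwise (t := univ)
    (f := fun ab : F × F => (cubicClass f (ab.1 + ab.2), cubicClass f (ab.1 + ab.2 * β),
      cubicClass f (ab.1 + ab.2 * β ^ 2))) (fun _ _ => by simp)]
  push_cast
  simp only [Fintype.sum_prod_type]
  refine Finset.sum_congr rfl fun i _ => Finset.sum_congr rfl fun j _ =>
    Finset.sum_congr rfl fun k _ => ?_
  rw [← card_solutions_eq_tripleFreq hF hψ hper, ← card_cubicClass_triple hF hβ hβ1 hβc]
  split_ifs with hx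
  · congr 2
    ext ab
    simp only [mem_filter, mem_univ, true_and, Prod.mk.injEq, and_iff_right_iff_imp]
    rintro ⟨h1, h2, h3⟩
    rw [hlam, h1, h2, h3, hx]
  · rw [Nat.cast_eq_zero, Finset.card_eq_zero, Finset.filter_eq_empty_iff]
    rintro ab hab h
    simp only [Prod.mk.injEq] at h
    simp only [mem_filter, mem_univ, true_and] at hab
    rw [hlam, h.1, h.2.1, h.2.2] at hab
    exact hx hab

end CodeWeight

theorem even_of_three_dvd_pow_sub_one {p s : ℕ} (hp3 : p % 3 = 2) (h : 3 ∣ p ^ s - 1) :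
    Even s := by
  by_contra hs
  obtain ⟨t, rfl⟩ := Nat.not_even_iff_odd.1 hs
  have h2 : p ^ (2 * t + 1) % 3 = 2 := by
    have : p ^ 2 % 3 = 1 := by rw [Nat.pow_mod, hp3]
    rw [pow_succ, pow_mul, Nat.mul_mod, Nat.pow_mod, this, hp3]
    simp
  omega

/-- The signed square root of `p ^ k` congruent to `1` modulo `3`. -/
theorem signed_sqrt_spec {p k : ℕ} (hp3 : p % 3 = 2) (hk : Even k) {ε : ℤ}
    (hε : ε = (-1) ^ (k / 2) * (p : ℤ) ^ (k / 2)) :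
    ε ^ 2 = (p : ℤ) ^ k ∧ (3 : ℤ) ∣ ε - 1 := by
  rw [← neg_pow] at hε
  subst hε
  constructor
  · rw [← pow_mul, Nat.div_mul_cancel hk.two_dvd, hk.neg_pow]
  · have h := sub_dvd_pow_sub_pow (-(p : ℤ)) 1 (k / 2)
    rw [one_pow] at h
    exact Dvd.dvd.trans (by omega) h

/-- Weight distribution of `C_{(q,m,h,3)}` for `e = N = 3`,
`p ≡ 2 (mod 3)` (p = 2 allowed) and `3 ∣ (q−1)/h` (Table 1). -/
theorem stmt_0 (p s m h : ℕ) (hp : p.Prime) (hp3 : p % 3 = 2) (hs : 1 ≤ s) (hm : 1 ≤ m)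
    (q r : ℕ) (hq : q = p ^ s) (hr : r = q ^ m)
    (hh : 0 < h) (hhq : h ∣ q - 1)
    (he : 3 ∣ Nat.gcd (q - 1) (h * m))
    (hN : Nat.gcd ((r - 1) / (q - 1)) (3 * (q - 1) / h) = 3)
    (hdvd : 3 ∣ (q - 1) / h)
    (K F : Type) [Field K] [Field F] [Algebra K F] [Fintype K] [Fintype F]
    (hcardK : Fintype.card K = q) (hcardF : Fintype.card F = r)
    (α : Fˣ) (hα : ∀ x : Fˣ, x ∈ Subgroup.zpowers α)
    (g β : F) (hg : g = (α : F) ^ ((q - 1) / h)) (hβ : β = (α : F) ^ ((r - 1) / 3))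
    (n : ℕ) (hn : n = h * (r - 1) / (q - 1))
    (lam : F → F → ℝ)
    (hlam : ∀ a b : F, lam a b = (h : ℝ) * ((r : ℝ) - 1) / q -
      (Set.ncard {i : Fin n |
        Algebra.trace K F (a * g ^ (i : ℕ) + b * (β * g) ^ (i : ℕ)) ≠ 0} : ℝ)) :
    Even (m * s) ∧
    ∀ ε : ℝ, ε = (-1 : ℝ) ^ (m * s / 2) * (p : ℝ) ^ (m * s / 2) →
      (∀ a b : F,
        lam a b = -((h : ℝ) * (2 * ε + 1)) / q ∨
        lam a b = (h : ℝ) * (ε - 1) / q ∨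
        lam a b = -((h : ℝ) * (ε + 1)) / q ∨
        lam a b = -(h : ℝ) / q ∨
        lam a b = (h : ℝ) * ((r : ℝ) - 4 * ε - 3) / (3 * q) ∨
        lam a b = (h : ℝ) * ((r : ℝ) + 2 * ε - 3) / (3 * q) ∨
        lam a b = (h : ℝ) * ((r : ℝ) - 1) / q) ∧
      (∀ x : ℝ, (Set.ncard {ab : F × F | lam ab.1 ab.2 = x} : ℝ) =
        (if -((h : ℝ) * (2 * ε + 1)) / q = x then
          ((r : ℝ) - 1) * ((r : ℝ) - 8 - 2 * ε) / 27 else 0) +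
        (if (h : ℝ) * (ε - 1) / q = x then
          2 * ((r : ℝ) - 1) * (4 * (r : ℝ) - 14 + ε) / 27 else 0) +
        (if -((h : ℝ) * (ε + 1)) / q = x then
          2 * ((r : ℝ) - 1) * ((r : ℝ) - 2 + ε) / 9 else 0) +
        (if -(h : ℝ) / q = x then
          2 * ((r : ℝ) - 1) * (2 * (r : ℝ) - 1 - ε) / 9 else 0) +
        (if (h : ℝ) * ((r : ℝ) - 4 * ε - 3) / (3 * q) = x then (r : ℝ) - 1 else 0) +
        (if (h : ℝ) * ((r : ℝ) + 2 * ε - 3) / (3 * q) = x then 2 * ((r : ℝ) - 1) else 0) +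
        (if (h : ℝ) * ((r : ℝ) - 1) / q = x then 1 else 0)) := by
  have := Fact.mk hp
  have hq2 : 2 ≤ q := hq ▸ hp.two_le.trans (Nat.le_self_pow (by omega) p)
  have h3q : 3 ∣ q - 1 := he.trans (Nat.gcd_dvd_left _ _)
  have hms : Even (m * s) := (even_of_three_dvd_pow_sub_one hp3 (hq ▸ h3q)).mul_left m
  refine ⟨hms, fun ε hε => ?_⟩
  obtain ⟨d, hdq⟩ := hhq
  have hd : (q - 1) / h = d := by rw [hdq, Nat.mul_div_cancel_left _ hh]
  have hd3 : 3 * (q - 1) / h = 3 * d := by rw [Nat.mul_div_assoc _ ⟨d, hdq⟩, hd]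
  rw [hd] at hdvd hg
  rw [hd3] at hN
  obtain ⟨M, hM⟩ : q - 1 ∣ r - 1 := by
    rw [hr]; simpa using Nat.sub_dvd_pow_sub_pow q 1 m
  have hMdiv : (r - 1) / (q - 1) = M := by rw [hM, Nat.mul_div_cancel_left _ (by omega)]
  rw [hMdiv] at hN
  obtain ⟨l₀, rfl⟩ : 3 ∣ M := hN ▸ Nat.gcd_dvd_left _ _
  have hr2 : q ≤ r := hr ▸ Nat.le_self_pow (by omega) q
  obtain ⟨f, hf⟩ : ∃ f, f = (q - 1) * l₀ := ⟨_, rfl⟩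
  have hrf : r = 3 * f + 1 := by
    have : r - 1 = 3 * f := by rw [hM, hf]; ring
    omega
  have hf0 : f ≠ 0 := by omega
  have hF : Fintype.card F = 3 * f + 1 := hcardF.trans hrf
  have hβf : β = (α : F) ^ f := by rw [hβ, hrf]; simp
  have hn3 : n = 3 * (h * l₀) := by
    rw [hn, hM, show h * ((q - 1) * (3 * l₀)) = (q - 1) * (3 * (h * l₀)) by ring,
      Nat.mul_div_cancel_left _ (by omega)]
  have hβ3 : β ^ 3 = 1 := hβf ▸ pow_third_pow_three hF α.ne_zero
  have hβ1 : β ≠ 1 := by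
    intro h1
    have ho : orderOf α = 3 * f := by
      rw [orderOf_eq_card_of_forall_mem_zpowers hα, Nat.card_eq_fintype_card, Fintype.card_units,
        hF, Nat.add_sub_cancel]
    have h2 : α ^ f = 1 := by ext; simpa [hβf] using h1
    have := Nat.le_of_dvd (by omega) (ho ▸ orderOf_dvd_of_pow_eq_one h2)
    omega
  have hβ2 : β ^ 2 + β + 1 = 0 := by
    apply mul_left_cancel₀ (sub_ne_zero.2 hβ1)
    linear_combination hβ3
  have hβc : cubicClass f β = 1 := by
    refine cubicClass_eq_one_iff.2 ⟨by simp [hβf], ?_⟩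
    obtain ⟨v, hv⟩ : 3 ∣ f := hf ▸ h3q.mul_right l₀
    conv_lhs => rw [hv, pow_mul, hβ3, one_pow]
  have : CharP K p := charP_of_card_eq_prime_pow (hcardK.trans hq)
  have : CharP F p := charP_of_injective_algebraMap (algebraMap K F).injective p
  obtain ⟨φ, hφ, hφp⟩ := exists_primitive_frobenius_invariant (K := K) p hp
  obtain ⟨ψ, hψdef⟩ : ∃ ψ : AddChar F ℂ,
    ψ = φ.compAddMonoidHom (Algebra.trace K F).toAddMonoidHom := ⟨_, rfl⟩
  have hψ : ψ.IsPrimitive := hψdef ▸ isPrimitive_comp_trace hφ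
  have hψφ (x : F) : ψ x = φ (Algebra.trace K F x) := by simp [hψdef]
  have hfrob (x : F) : ψ (x ^ p) = ψ x := by
    rw [hψφ, hψφ, trace_pow_char p hp, hφp]
  obtain ⟨E, hE⟩ : ∃ E : ℤ, E = (-1) ^ (m * s / 2) * (p : ℤ) ^ (m * s / 2) := ⟨_, rfl⟩
  have hεE : ε = E := by rw [hε, hE]; push_cast; rfl
  obtain ⟨hEsq, hE3⟩ := signed_sqrt_spec hp3 hms hE
  have hrp : r = p ^ (m * s) := by rw [hr, hq, ← pow_mul, mul_comm]
  have hEr : E ^ 2 = r := by rw [hEsq, hrp]; push_cast; rfl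
  have hper (c : F) : classSum ψ f 1 c = (cubicPeriod f ε (cubicClass f c) : ℝ) := by
    rw [hεE]
    exact classSum_one_eq_cubicPeriod hp hp3 hF hf0 hψ hfrob (by rw [hEr, hrf]; push_cast; rfl) hE3 c
  have hκ : algebraMap K F (Algebra.norm K (α : F)) = (α : F) ^ (3 * l₀) := by
    have hfin : Module.finrank K F = m := by
      have h1 := Module.card_eq_pow_finrank (K := K) (V := F)
      rw [hcardF, hcardK, hr] at h1
      exact (Nat.pow_right_injective hq2 h1).symm
    rw [FiniteField.algebraMap_norm_eq_pow_sum, hfin, Nat.card_eq_fintype_card, hcardK,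
      Nat.geomSum_eq hq2, ← hr, hMdiv]
  have hκ0 : Algebra.norm K (α : F) ≠ 0 := by
    intro h0
    rw [h0, map_zero] at hκ
    exact pow_ne_zero _ α.ne_zero hκ.symm
  have hlam' (a b : F) : lam a b = (h : ℝ) / q * (cubicPeriod f ε (cubicClass f (a + b)) +
      cubicPeriod f ε (cubicClass f (a + b * β)) +
      cubicPeriod f ε (cubicClass f (a + b * β ^ 2))) := by
    have hz := card_mul_card_zero_coords hφ hψφ hα hF hf0 (κ := Units.mk0 _ hκ0) hκ hN hdvd
      (l := h * l₀) (h := h) (by rw [hcardK, hf]; simp) (by rw [hf, hdq]; ring)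
      (by rw [hcardK, hf]; ring) hg hβ3 a b
    rw [hper, hper, hper, hcardK, ← hn3] at hz
    have hz' : (q : ℝ) * #{i ∈ range n | Algebra.trace K F (a * g ^ i + b * (β * g) ^ i) = 0} =
      n + h * (cubicPeriod f ε (cubicClass f (a + b)) +
      cubicPeriod f ε (cubicClass f (a + b * β)) +
      cubicPeriod f ε (cubicClass f (a + b * β ^ 2))) := by exact_mod_cast hz
    have hcard : Set.ncard {i : Fin n |
          Algebra.trace K F (a * g ^ (i : ℕ) + b * (β * g) ^ (i : ℕ)) ≠ 0} +
        #{i ∈ range n | Algebra.trace K F (a * g ^ i + b * (β * g) ^ i) = 0} = n := by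
      rw [Set.ncard_eq_toFinset_card', Set.toFinset_ofPred, Finset.card_filter,
        Fin.sum_univ_eq_sum_range
          (fun i => if Algebra.trace K F (a * g ^ i + b * (β * g) ^ i) ≠ 0 then 1 else 0),
        ← Finset.card_filter, add_comm, Finset.card_filter_add_card_filter_not, card_range]
    have hcard' : (Set.ncard {i : Fin n |
          Algebra.trace K F (a * g ^ (i : ℕ) + b * (β * g) ^ (i : ℕ)) ≠ 0} : ℝ) =
        n - #{i ∈ range n | Algebra.trace K F (a * g ^ i + b * (β * g) ^ i) = 0} := by
      rw [eq_sub_iff_add_eq]; exact_mod_cast hcard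
    have hnq : (n : ℝ) * (q - 1) = h * (r - 1) := by
      have : n * (q - 1) = h * (r - 1) := by rw [hn3, hM]; ring
      rw [← Nat.cast_one, ← Nat.cast_sub (by omega), ← Nat.cast_sub (by omega)]
      exact_mod_cast this
    have hq0 : (q : ℝ) ≠ 0 := by positivity
    rw [hlam, hcard']
    field_simp
    linear_combination hz' - hnq
  have hdist (x : ℝ) := (card_lam_eq hF hψ hper hβ2 hβ1 hβc hlam' x).trans
    (sum_tripleFreq_ite (r := r) (by rw [hrf]; push_cast; rfl)
      (by rw [hεE]; exact_mod_cast hEr) h q x)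
  refine ⟨fun a b => ?_, hdist⟩
  by_contra! hne
  obtain ⟨h1, h2, h3, h4, h5, h6, h7⟩ := hne
  have h0 := hdist (lam a b)
  rw [if_neg h1.symm, if_neg h2.symm, if_neg h3.symm, if_neg h4.symm, if_neg h5.symm,
    if_neg h6.symm, if_neg h7.symm] at h0
  simp only [add_zero, Nat.cast_eq_zero] at h0
  rw [Set.ncard_eq_zero] at h0
  exact h0.subset (show (a, b) ∈ {ab : F × F | lam ab.1 ab.2 = lam a b} from rfl)
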